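/- arXiv:1205.0171 — 2 statements merged into one kernel-verified Lean document; each statement's English description precedes it below -/
import Mathlib

section
/- Let 0 < p < ∞ and α > -1. Then there is a constant C = C(p, α, n) such that for every harmonic function f on the upper half space ℝ^{n+1}_+ = {(x,t) : x ∈ ℝⁿ, t > 0} with ∫_{ℝ^{n+1}_+} |f(x,t)|^p t^α dx dt < ∞, one has |f(x,t)| ≤ C t^{-(α+n+1)/p} (∫_{ℝ^{n+1}_+} |f|^p s^α dy ds)^{1/p} for all (x,t) ∈ ℝ^{n+1}_+. -/
open MeasureTheory

/-- A function on `ℝⁿ × ℝ` is harmonic on a set if it is `C²` there and its Laplacian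
(sum of pure second derivatives in the horizontal coordinate directions and the
vertical direction) vanishes. -/
def HarmonicOnUpper (n : ℕ) (f : EuclideanSpace ℝ (Fin n) × ℝ → ℝ)
    (s : Set (EuclideanSpace ℝ (Fin n) × ℝ)) : Prop :=
  ContDiffOn ℝ 2 f s ∧ ∀ z ∈ s,
    (∑ i : Fin n, iteratedFDeriv ℝ 2 f z
      ![(EuclideanSpace.single i (1 : ℝ), (0 : ℝ)),
        (EuclideanSpace.single i (1 : ℝ), (0 : ℝ))]) +
      iteratedFDeriv ℝ 2 f z ![((0 : EuclideanSpace ℝ (Fin n)), (1 : ℝ)),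
        ((0 : EuclideanSpace ℝ (Fin n)), (1 : ℝ))] = 0

open Set Metric Topology

theorem hasDerivAt_max_zero_sq (s : ℝ) :
    HasDerivAt (fun s : ℝ => max s 0 ^ 2) (2 * max s 0) s := by
  rcases lt_trichotomy s 0 with hs | rfl | hs
  · have h : (fun s : ℝ => max s 0 ^ 2) =ᶠ[𝓝 s] fun _ => 0 := by
      filter_upwards [Iio_mem_nhds hs] with t ht
      simp [max_eq_right (mem_Iio.1 ht).le]
    rw [max_eq_right hs.le, mul_zero]
    exact (hasDerivAt_const s (0 : ℝ)).congr_of_eventuallyEq h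
  · rw [max_self, mul_zero]
    have h : (fun s : ℝ => max s 0 ^ 2) =O[𝓝 0] fun s => ‖s - 0‖ ^ 2 := by
      refine Asymptotics.IsBigO.of_bound 1 (Filter.Eventually.of_forall fun t => ?_)
      rcases le_total t 0 with ht | ht <;> simp [ht, sq_nonneg]
    simpa using (h.hasFDerivAt (𝕜 := ℝ) one_lt_two).hasDerivAt
  · have h : (fun s : ℝ => max s 0 ^ 2) =ᶠ[𝓝 s] fun s => s ^ 2 := by
      filter_upwards [Ioi_mem_nhds hs] with t ht
      simp [max_eq_left (mem_Ioi.1 ht).le]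
    rw [max_eq_left hs.le]
    simpa using (hasDerivAt_pow 2 s).congr_of_eventuallyEq h

section
variable {V ι : Type*} [NormedAddCommGroup V] [NormedSpace ℝ V] [Fintype ι]

/-- The radial weight `(1 - |y|²)₊`, where `|y|` is the Euclidean length in the basis `b`. -/
noncomputable def radialWeight (b : Module.Basis ι ℝ V) (y : V) : ℝ :=
  max (1 - ∑ i, b.repr y i ^ 2) 0

theorem radialWeight_nonneg (b : Module.Basis ι ℝ V) (y : V) : 0 ≤ radialWeight b y :=
  le_max_right _ _

theorem radialWeight_le_one (b : Module.Basis ι ℝ V) (y : V) : radialWeight b y ≤ 1 :=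
  max_le (sub_le_self _ (Finset.sum_nonneg fun _ _ => sq_nonneg _)) zero_le_one

theorem radialWeight_zero (b : Module.Basis ι ℝ V) : radialWeight b 0 = 1 := by
  simp [radialWeight]

theorem radialWeight_eq_zero_of_one_le_norm {b : Module.Basis ι ℝ V}
    (hb : ∀ y, ‖y‖ ^ 2 ≤ ∑ i, b.repr y i ^ 2) {y : V} (hy : 1 ≤ ‖y‖) : radialWeight b y = 0 :=
  max_eq_right (by nlinarith [hb y])

theorem hasCompactSupport_radialWeight [FiniteDimensional ℝ V] {b : Module.Basis ι ℝ V}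
    (hb : ∀ y, ‖y‖ ^ 2 ≤ ∑ i, b.repr y i ^ 2) : HasCompactSupport (radialWeight b) := by
  have := FiniteDimensional.proper ℝ V
  refine HasCompactSupport.intro (isCompact_closedBall (0 : V) 1) fun y hy => ?_
  refine radialWeight_eq_zero_of_one_le_norm hb ?_
  simp only [mem_closedBall, dist_zero_right, not_le] at hy
  exact hy.le

theorem hasFDerivAt_sum_repr_sq [FiniteDimensional ℝ V] (b : Module.Basis ι ℝ V) (y : V) :
    HasFDerivAt (fun y => ∑ i, b.repr y i ^ 2)
      (∑ i, (2 * b.repr y i) • (b.coord i).toContinuousLinearMap) y := by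
  refine HasFDerivAt.fun_sum fun i _ => ?_
  simpa using ((b.coord i).toContinuousLinearMap.hasFDerivAt (x := y)).pow 2

theorem continuous_radialWeight [FiniteDimensional ℝ V] (b : Module.Basis ι ℝ V) :
    Continuous (radialWeight b) := by
  have h : Continuous fun y => ∑ i, b.repr y i ^ 2 :=
    continuous_iff_continuousAt.2 fun y => (hasFDerivAt_sum_repr_sq b y).continuousAt
  exact (continuous_const.sub h).max continuous_const

theorem hasFDerivAt_radialWeight_sq [FiniteDimensional ℝ V] (b : Module.Basis ι ℝ V) (y : V) :
    HasFDerivAt (fun y => radialWeight b y ^ 2)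
      ((2 * radialWeight b y) • -(∑ i, (2 * b.repr y i) • (b.coord i).toContinuousLinearMap)) y :=
  (hasDerivAt_max_zero_sq _).comp_hasFDerivAt y ((hasFDerivAt_sum_repr_sq b y).const_sub 1)

theorem fderiv_radialWeight_sq_apply [FiniteDimensional ℝ V] [DecidableEq ι]
    (b : Module.Basis ι ℝ V) (y : V) (i : ι) :
    fderiv ℝ (fun y => radialWeight b y ^ 2) y (b i) = -4 * (b.repr y i * radialWeight b y) := by
  rw [(hasFDerivAt_radialWeight_sq b y).fderiv]
  simp [Finsupp.single_apply]
  ring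


theorem sum_integral_mul_repr_mul_radialWeight_eq_zero [FiniteDimensional ℝ V]
    [MeasurableSpace V] [BorelSpace V] (μ : Measure V) [μ.IsAddHaarMeasure]
    {b : Module.Basis ι ℝ V} (hb : ∀ y, ‖y‖ ^ 2 ≤ ∑ i, b.repr y i ^ 2) {G : ι → V → ℝ}
    (hG : ∀ i, ContDiff ℝ 1 (G i))
    (hdiv : ∀ y ∈ ball (0 : V) 1, ∑ i, fderiv ℝ (G i) y (b i) = 0) :
    ∑ i, ∫ y, G i y * (b.repr y i * radialWeight b y) ∂μ = 0 := by
  classical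
  have hsupp := hasCompactSupport_radialWeight hb
  have hcont := continuous_radialWeight b
  have hrepr (i : ι) : Continuous fun y => b.repr y i :=
    (b.coord i).continuous_of_finiteDimensional
  have hG' (i : ι) : Continuous fun y => fderiv ℝ (G i) y (b i) :=
    ((hG i).continuous_fderiv one_ne_zero).clm_apply continuous_const
  have hinteg {u : V → ℝ} (hu : Continuous u) :
      Integrable (fun y => u y * radialWeight b y) μ :=
    (hu.mul hcont).integrable_of_hasCompactSupport hsupp.mul_left
  have hinteg' (i : ι) : Integrable (fun y => fderiv ℝ (G i) y (b i) * radialWeight b y ^ 2) μ := by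
    simpa only [pow_two, mul_assoc, Pi.mul_apply] using hinteg ((hG' i).mul hcont)
  have key (i : ι) : ∫ y, G i y * (b.repr y i * radialWeight b y) ∂μ =
      4⁻¹ * ∫ y, fderiv ℝ (G i) y (b i) * radialWeight b y ^ 2 ∂μ := by
    have h := integral_mul_fderiv_eq_neg_fderiv_mul_of_integrable (μ := μ) (f := G i)
      (g := fun y => radialWeight b y ^ 2) (v := b i) (hinteg' i) ?_ ?_
      (fun y _ => (hG i).differentiable one_ne_zero y)
      (fun y _ => (hasFDerivAt_radialWeight_sq b y).differentiableAt)
    · simp only [fderiv_radialWeight_sq_apply, mul_left_comm (G i _) (-4 : ℝ),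
        integral_const_mul] at h
      linarith
    · simp only [fderiv_radialWeight_sq_apply]
      refine ((hinteg ((hG i).continuous.mul (hrepr i))).const_mul (-4)).congr
        (.of_forall fun y => ?_)
      simp only [Pi.mul_apply]
      ring
    · simpa only [pow_two, mul_assoc, Pi.mul_apply] using hinteg ((hG i).continuous.mul hcont)
  simp only [key]
  rw [← Finset.mul_sum, ← integral_finsetSum _ fun i _ => hinteg' i]
  simp only [← Finset.sum_mul]
  rw [integral_eq_zero_of_ae, mul_zero]
  refine .of_forall fun y => ?_
  by_cases hy : ‖y‖ < 1
  · simp [hdiv y (by simpa using hy)]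
  · simp [radialWeight_eq_zero_of_one_le_norm hb (not_lt.1 hy)]

theorem integral_comp_mul_radialWeight_eq [FiniteDimensional ℝ V]
    [MeasurableSpace V] [BorelSpace V] (μ : Measure V) [μ.IsAddHaarMeasure]
    {b : Module.Basis ι ℝ V} (hb : ∀ y, ‖y‖ ^ 2 ≤ ∑ i, b.repr y i ^ 2) {f : V → ℝ}
    (hf : ContDiff ℝ 2 f) (hfc : HasCompactSupport f) {z : V} {R : ℝ} (hR : 0 < R)
    (hlap : ∀ w ∈ ball z R, ∑ i, fderiv ℝ (fderiv ℝ f) w (b i) (b i) = 0) :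
    ∫ y, f (z + R • y) * radialWeight b y ∂μ = f z * ∫ y, radialWeight b y ∂μ := by
  have hsupp := hasCompactSupport_radialWeight hb
  have hcont := continuous_radialWeight b
  have hdf : ContDiff ℝ 1 (fderiv ℝ f) := hf.fderiv_right (by norm_num)
  obtain ⟨K, hK⟩ := hdf.continuous.bounded_above_of_compact_support (hfc.fderiv (𝕜 := ℝ))
  have hinteg {u : V → ℝ} (hu : Continuous u) :
      Integrable (fun y => u y * radialWeight b y) μ :=
    (hu.mul hcont).integrable_of_hasCompactSupport hsupp.mul_left
  have haff (r : ℝ) : Continuous fun y : V => z + r • y := by fun_prop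
  have hderiv (r : ℝ) : HasDerivAt (fun r : ℝ => ∫ y, f (z + r • y) * radialWeight b y ∂μ)
      (∫ y, fderiv ℝ f (z + r • y) y * radialWeight b y ∂μ) r := by
    refine (hasDerivAt_integral_of_dominated_loc_of_deriv_le
      (F := fun r y => f (z + r • y) * radialWeight b y)
      (F' := fun r y => fderiv ℝ f (z + r • y) y * radialWeight b y)
      (bound := fun y => K * ‖y‖ * radialWeight b y)
      Filter.univ_mem (.of_forall fun r => ?_) ?_ ?_ ?_ ?_ ?_).2
    · exact (hinteg (hf.continuous.comp (haff r))).aestronglyMeasurable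
    · exact hinteg (hf.continuous.comp (haff r))
    · exact (hinteg ((hdf.continuous.comp (haff r)).clm_apply continuous_id)).aestronglyMeasurable
    · refine .of_forall fun y r _ => ?_
      rw [norm_mul, Real.norm_of_nonneg (radialWeight_nonneg b y)]
      exact mul_le_mul_of_nonneg_right ((fderiv ℝ f _).le_of_opNorm_le (hK _) y)
        (radialWeight_nonneg b y)
    · exact hinteg (by fun_prop)
    · refine .of_forall fun y r _ => HasDerivAt.mul_const ?_ _
      have h1 : HasDerivAt (fun r : ℝ => z + r • y) y r := by
        simpa using ((hasDerivAt_id r).smul_const y).const_add z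
      exact ((hf.differentiable two_ne_zero _).hasFDerivAt.comp_hasDerivAt r h1)
  have hzero (r : ℝ) (hr : r ∈ Ico 0 R) :
      ∫ y, fderiv ℝ f (z + r • y) y * radialWeight b y ∂μ = 0 := by
    have hG (i : ι) : ContDiff ℝ 1 fun y => fderiv ℝ f (z + r • y) (b i) :=
      (hdf.comp (by fun_prop : ContDiff ℝ 1 fun y : V => z + r • y)).clm_apply contDiff_const
    have hG' (i : ι) (y v : V) : fderiv ℝ (fun y => fderiv ℝ f (z + r • y) (b i)) y v =
        r * fderiv ℝ (fderiv ℝ f) (z + r • y) v (b i) := by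
      have h1 : HasFDerivAt (fun y : V => z + r • y) (r • ContinuousLinearMap.id ℝ V) y :=
        ((hasFDerivAt_id y).const_smul r).const_add z
      have h2 := ((hdf.differentiable one_ne_zero (z + r • y)).hasFDerivAt.comp y h1).clm_apply
        (hasFDerivAt_const (b i) y)
      have h3 := h2.fderiv
      simp only [Function.comp_def] at h3
      rw [h3]
      simp
    rw [← sum_integral_mul_repr_mul_radialWeight_eq_zero μ hb hG fun y hy => ?_,
      ← integral_finsetSum]
    · refine integral_congr_ae (.of_forall fun y => ?_)
      simp only [← mul_assoc, ← Finset.sum_mul]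
      congr 1
      have h := congrArg (fderiv ℝ f (z + r • y)) (b.sum_repr y)
      rw [← h, map_sum]
      simp only [map_smul, smul_eq_mul, mul_comm]
    · intro i _
      simp only [← mul_assoc]
      exact hinteg ((hG i).continuous.mul (b.coord i).continuous_of_finiteDimensional)
    · simp only [hG', ← Finset.mul_sum]
      rw [hlap, mul_zero]
      rw [mem_ball_zero_iff] at hy
      rw [mem_ball_iff_norm, add_sub_cancel_left, norm_smul, Real.norm_of_nonneg hr.1]
      nlinarith [hr.1, hr.2, norm_nonneg y]
  have hfin := constant_of_derivWithin_zero
    (fun r _ => (hderiv r).differentiableAt.differentiableWithinAt)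
    (fun r hr => by
      rw [(hderiv r).hasDerivWithinAt.derivWithin
        (uniqueDiffOn_Icc hR r (Ico_subset_Icc_self hr)), hzero r hr])
    R (right_mem_Icc.2 hR.le)
  rw [hfin]
  simp [integral_const_mul]

/-- Harmonicity, with respect to the basis `b`, of a `C²` function on the set `U`. -/
def HarmonicOnBasis (b : Module.Basis ι ℝ V) (f : V → ℝ) (U : Set V) : Prop :=
  ContDiffOn ℝ 2 f U ∧ ∀ w ∈ U, ∑ i, fderiv ℝ (fderiv ℝ f) w (b i) (b i) = 0

theorem HarmonicOnBasis.abs_mul_integral_radialWeight_le [FiniteDimensional ℝ V]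
    [MeasurableSpace V] [BorelSpace V] (μ : Measure V) [μ.IsAddHaarMeasure]
    {b : Module.Basis ι ℝ V} (hb : ∀ y, ‖y‖ ^ 2 ≤ ∑ i, b.repr y i ^ 2) {f : V → ℝ} {U : Set V}
    (hf : HarmonicOnBasis b f U) (hU : IsOpen U) {z : V} {R : ℝ} (hR : 0 < R)
    (hzU : closedBall z (2 * R) ⊆ U) :
    |f z| * ∫ y, radialWeight b y ∂μ ≤
      (R ^ Module.finrank ℝ V)⁻¹ * ∫ w in ball z R, |f w| ∂μ := by
  have := FiniteDimensional.proper ℝ V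
  have hRR : R < 2 * R := by linarith
  let χ : ContDiffBump z := ⟨R, 2 * R, hR, hRR⟩
  have hχ1 {w : V} (hw : w ∈ closedBall z R) : χ w = 1 := χ.one_of_mem_closedBall hw
  have hsupp : tsupport (fun w => χ w * f w) ⊆ closedBall z (2 * R) :=
    (closure_mono (Function.support_mul_subset_left _ _)).trans χ.tsupport_eq.subset
  have hsmooth : ContDiff ℝ 2 fun w => χ w * f w :=
    (contMDiff_of_tsupport fun w hw => (χ.contDiff.contDiffAt.mul
      (hf.1.contDiffAt (hU.mem_nhds (hzU (hsupp hw))))).contMDiffAt).contDiff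
  have hcomp : HasCompactSupport fun w => χ w * f w :=
    (isCompact_closedBall z (2 * R)).of_isClosed_subset (isClosed_tsupport _) hsupp
  have hball : ball z R ⊆ U :=
    (ball_subset_closedBall.trans (closedBall_subset_closedBall hRR.le)).trans hzU
  have hlap (w : V) (hw : w ∈ ball z R) :
      ∑ i, fderiv ℝ (fderiv ℝ fun w => χ w * f w) w (b i) (b i) = 0 := by
    have heq : (fun w => χ w * f w) =ᶠ[𝓝 w] f := by
      filter_upwards [isOpen_ball.mem_nhds hw] with u hu
      rw [hχ1 (ball_subset_closedBall hu), one_mul]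
    rw [heq.fderiv.fderiv_eq]
    exact hf.2 w (hball hw)
  have hmean := integral_comp_mul_radialWeight_eq μ hb hsmooth hcomp hR hlap
  simp only [hχ1 (mem_closedBall_self hR.le), one_mul] at hmean
  have hinteg : Integrable ((ball z R).indicator fun w => |f w|) μ := by
    rw [integrable_indicator_iff measurableSet_ball]
    exact (((hf.1.continuousOn.mono hzU).abs.integrableOn_compact
      (isCompact_closedBall z (2 * R))).mono_set
        (ball_subset_closedBall.trans (closedBall_subset_closedBall hRR.le)))
  have hinteg' : Integrable (fun y => (ball z R).indicator (fun w => |f w|) (z + R • y)) μ :=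
    (hinteg.comp_add_left z).comp_smul hR.ne'
  have hw0 : 0 ≤ ∫ y, radialWeight b y ∂μ := integral_nonneg (radialWeight_nonneg b)
  calc |f z| * ∫ y, radialWeight b y ∂μ
      = ‖∫ y, χ (z + R • y) * f (z + R • y) * radialWeight b y ∂μ‖ := by
        rw [hmean, norm_mul, Real.norm_of_nonneg hw0, Real.norm_eq_abs]
    _ ≤ ∫ y, (ball z R).indicator (fun w => |f w|) (z + R • y) ∂μ := by
        refine norm_integral_le_of_norm_le hinteg' (.of_forall fun y => ?_)
        rcases lt_or_ge ‖y‖ 1 with hy | hy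
        · have hmem : z + R • y ∈ ball z R := by
            rw [mem_ball_iff_norm, add_sub_cancel_left, norm_smul, Real.norm_of_nonneg hR.le]
            nlinarith
          rw [indicator_of_mem hmem, hχ1 (ball_subset_closedBall hmem), one_mul, norm_mul,
            Real.norm_of_nonneg (radialWeight_nonneg b y), Real.norm_eq_abs]
          exact mul_le_of_le_one_right (abs_nonneg _) (radialWeight_le_one b y)
        · rw [radialWeight_eq_zero_of_one_le_norm hb hy, mul_zero, norm_zero]
          exact indicator_nonneg (fun _ _ => abs_nonneg _) _
    _ = (R ^ Module.finrank ℝ V)⁻¹ * ∫ w in ball z R, |f w| ∂μ := by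
        rw [Measure.integral_comp_smul_of_nonneg μ
          (fun x => (ball z R).indicator (fun w => |f w|) (z + x)) R (hR := hR.le), smul_eq_mul,
          integral_add_left_eq_self (fun x => (ball z R).indicator (fun w => |f w|) x),
          integral_indicator measurableSet_ball]

theorem integral_radialWeight_pos [FiniteDimensional ℝ V]
    [MeasurableSpace V] [BorelSpace V] (μ : Measure V) [μ.IsAddHaarMeasure]
    {b : Module.Basis ι ℝ V} (hb : ∀ y, ‖y‖ ^ 2 ≤ ∑ i, b.repr y i ^ 2) :
    0 < ∫ y, radialWeight b y ∂μ :=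
  (continuous_radialWeight b).integral_pos_of_hasCompactSupport_nonneg_nonzero
    (hasCompactSupport_radialWeight hb) (radialWeight_nonneg b) (x := 0)
    (by simp [radialWeight_zero])

end

section
variable {V : Type*} [NormedAddCommGroup V] [NormedSpace ℝ V] [FiniteDimensional ℝ V]
  [MeasurableSpace V] [BorelSpace V]

/-- The sub-mean value property with constant `A` on all balls whose double lies in `B`. -/
def SubMeanOn (μ : Measure V) (A : ℝ) (f : V → ℝ) (B : Set V) : Prop :=
  ∀ w : V, ∀ ρ : ℝ, 0 < ρ → closedBall w (2 * ρ) ⊆ B →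
    |f w| ≤ A * (ρ ^ Module.finrank ℝ V)⁻¹ * ∫ y in ball w ρ, |f y| ∂μ

theorem SubMeanOn.abs_rpow_le_of_one_le {μ : Measure V} [μ.IsAddHaarMeasure]
    {A p r : ℝ}
    (hA : 0 < A) (hp : 1 ≤ p) (hr : 0 < r) {f : V → ℝ} {z : V}
    (hf : ContinuousOn f (closedBall z r)) (hmean : SubMeanOn μ A f (closedBall z r)) :
    |f z| ^ p ≤ (A * 2 ^ Module.finrank ℝ V * (μ.real (ball 0 1) + 1)) ^ p *
      ((r ^ Module.finrank ℝ V)⁻¹ * ∫ y in ball z r, |f y| ^ p ∂μ) := by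
  have := FiniteDimensional.proper ℝ V
  have hp0 : 0 < p := by linarith
  set d := Module.finrank ℝ V
  set v := μ.real (ball (0 : V) 1)
  set J := ∫ y in ball z r, |f y| ^ p ∂μ
  set X := (r ^ d)⁻¹ * J with hX
  have hv : 0 ≤ v := measureReal_nonneg
  have hJ : 0 ≤ J := integral_nonneg fun _ => Real.rpow_nonneg (abs_nonneg _) _
  have hX0 : 0 ≤ X := by positivity
  have hrd : 0 < r ^ d := by positivity
  have hJX : J = r ^ d * X := by rw [hX]; field_simp
  have hfi : IntegrableOn (fun y => |f y|) (ball z r) μ :=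
    (hf.abs.integrableOn_compact (isCompact_closedBall z r)).mono_set ball_subset_closedBall
  have hfp : IntegrableOn (fun y => |f y| ^ p) (ball z r) μ :=
    ((hf.abs.rpow_const fun _ _ => Or.inr hp0.le).integrableOn_compact
      (isCompact_closedBall z r)).mono_set ball_subset_closedBall
  have hvol : μ.real (ball z r) = r ^ d * v := by
    rw [Measure.real, Measure.addHaar_ball_of_pos μ z hr, ENNReal.toReal_mul,
      ENNReal.toReal_ofReal hrd.le]
    rfl
  have hsub : ball z (r / 2) ⊆ ball z r := ball_subset_ball (by linarith)
  have hbound (l : ℝ) (hl : 0 < l) (hXl : X ≤ l ^ p) : |f z| ≤ A * 2 ^ d * (v + 1) * l := by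
    have hpt (t : ℝ) (ht : 0 ≤ t) : t ≤ l + l ^ (1 - p) * t ^ p := by
      rcases le_or_gt t l with h | h
      · exact le_add_of_le_of_nonneg h (by positivity)
      · have ht' : 0 < t := hl.trans h
        have h1 : t ^ (1 - p) ≤ l ^ (1 - p) :=
          Real.rpow_le_rpow_of_nonpos hl h.le (by linarith)
        have h2 : t = t ^ (1 - p) * t ^ p := by
          rw [← Real.rpow_add ht', sub_add_cancel, Real.rpow_one]
        calc t = t ^ (1 - p) * t ^ p := h2
          _ ≤ l ^ (1 - p) * t ^ p := by gcongr
          _ ≤ _ := le_add_of_nonneg_left hl.le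
    have hconst : Integrable (fun _ => l) (μ.restrict (ball z r)) :=
      integrableOn_const measure_ball_lt_top.ne
    have hinteg : ∫ y in ball z (r / 2), |f y| ∂μ ≤ r ^ d * ((v + 1) * l) := by
      calc ∫ y in ball z (r / 2), |f y| ∂μ ≤ ∫ y in ball z r, |f y| ∂μ :=
            setIntegral_mono_set hfi (.of_forall fun _ => abs_nonneg _) hsub.eventuallyLE
        _ ≤ ∫ y in ball z r, (l + l ^ (1 - p) * |f y| ^ p) ∂μ :=
            integral_mono hfi (hconst.add (hfp.const_mul _)) fun y => hpt _ (abs_nonneg _)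
        _ = r ^ d * v * l + l ^ (1 - p) * (r ^ d * X) := by
            rw [integral_add hconst (hfp.const_mul _),
              setIntegral_const, integral_const_mul, smul_eq_mul, hvol, ← hJX]
        _ ≤ r ^ d * v * l + l ^ (1 - p) * (r ^ d * l ^ p) := by gcongr
        _ = r ^ d * v * l + r ^ d * (l ^ (1 - p) * l ^ p) := by ring
        _ = r ^ d * ((v + 1) * l) := by
            rw [← Real.rpow_add hl, sub_add_cancel, Real.rpow_one]
            ring
    calc |f z| ≤ A * ((r / 2) ^ d)⁻¹ * ∫ y in ball z (r / 2), |f y| ∂μ :=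
          hmean z (r / 2) (by linarith) (closedBall_subset_closedBall (by linarith))
      _ ≤ A * ((r / 2) ^ d)⁻¹ * (r ^ d * ((v + 1) * l)) := by gcongr
      _ = A * 2 ^ d * (v + 1) * l := by
          rw [div_pow]
          field_simp
  set K := A * 2 ^ d * (v + 1)
  have hK : 0 < K := by positivity
  have hle : |f z| / K ≤ X ^ (1 / p) := by
    refine le_of_forall_gt_imp_ge_of_dense fun l hl => ?_
    have hl0 : 0 < l := (Real.rpow_nonneg hX0 _).trans_lt hl
    rw [div_le_iff₀' hK]
    refine hbound l hl0 ?_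
    rw [one_div] at hl
    exact ((Real.rpow_inv_lt_iff_of_pos hX0 hl0.le hp0).1 hl).le
  rw [div_le_iff₀' hK] at hle
  calc |f z| ^ p ≤ (K * X ^ (1 / p)) ^ p := by gcongr
    _ = K ^ p * X := by
      rw [Real.mul_rpow hK.le (by positivity), ← Real.rpow_mul hX0, one_div,
        inv_mul_cancel₀ hp0.ne', Real.rpow_one]

theorem SubMeanOn.abs_rpow_le_of_lt_one [Nontrivial V] {μ : Measure V} [μ.IsAddHaarMeasure]
    {A p r : ℝ}
    (hA : 0 < A) (hp0 : 0 < p) (hp : p < 1) (hr : 0 < r) {f : V → ℝ} {z : V}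
    (hf : ContinuousOn f (closedBall z r)) (hmean : SubMeanOn μ A f (closedBall z r)) :
    |f z| ^ p ≤ A * 2 ^ (Module.finrank ℝ V / p) *
      ((r ^ Module.finrank ℝ V)⁻¹ * ∫ y in ball z r, |f y| ^ p ∂μ) := by
  have := FiniteDimensional.proper ℝ V
  set d := Module.finrank ℝ V
  set J := ∫ y in ball z r, |f y| ^ p ∂μ
  have hJ : 0 ≤ J := integral_nonneg fun _ => Real.rpow_nonneg (abs_nonneg _) _
  have hpow (s : ℝ) (hs : 0 ≤ s) : (s ^ (d / p)) ^ p = s ^ d := by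
    rw [← Real.rpow_mul hs, div_mul_cancel₀ _ hp0.ne', Real.rpow_natCast]
  have hfp : IntegrableOn (fun y => |f y| ^ p) (ball z r) μ :=
    ((hf.abs.rpow_const fun _ _ => Or.inr hp0.le).integrableOn_compact
      (isCompact_closedBall z r)).mono_set ball_subset_closedBall
  have hgc : ContinuousOn (fun w => |f w| * (r - dist w z) ^ (d / p)) (closedBall z r) :=
    hf.abs.mul ((by fun_prop : Continuous fun w => r - dist w z).continuousOn.rpow_const
      fun _ _ => Or.inr (by positivity))
  obtain ⟨w, hw, hmax⟩ := (isCompact_closedBall z r).exists_isMaxOn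
    ⟨z, mem_closedBall_self hr.le⟩ hgc
  have hzmax : |f z| * r ^ (d / p) ≤ |f w| * (r - dist w z) ^ (d / p) := by
    simpa using hmax (mem_closedBall_self hr.le)
  have hrd : 0 < r ^ d := by positivity
  by_cases hfz : f z = 0
  · rw [hfz, abs_zero, Real.zero_rpow hp0.ne']
    positivity
  have hMpos : 0 < |f w| * (r - dist w z) ^ (d / p) :=
    lt_of_lt_of_le (by positivity) hzmax
  have hd : (d / p : ℝ) ≠ 0 := by
    have : 0 < d := Module.finrank_pos
    positivity
  have hδ : 0 < r - dist w z := by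
    refine lt_of_le_of_ne (sub_nonneg.2 hw) fun h => ?_
    rw [← h, Real.zero_rpow hd, mul_zero] at hMpos
    exact hMpos.false
  obtain ⟨ρ, hρ⟩ : ∃ ρ, r - dist w z = 2 * ρ := ⟨(r - dist w z) / 2, by ring⟩
  have hρ0 : 0 < ρ := by linarith
  rw [hρ, Real.mul_rpow zero_le_two hρ0.le] at hzmax hMpos
  set N := |f w| * 2 ^ (d / p) with hN
  have hN0 : 0 < N := by
    rw [← mul_assoc] at hMpos
    exact pos_of_mul_pos_left hMpos (by positivity)
  have hsub : ball w ρ ⊆ ball z r := ball_subset_ball' (by linarith)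
  have hle (y : V) (hy : y ∈ ball w ρ) : |f y| ≤ N := by
    have h1 : |f y| * (r - dist y z) ^ (d / p) ≤ |f w| * (r - dist w z) ^ (d / p) :=
      hmax (ball_subset_closedBall (hsub hy))
    have h2 : ρ ≤ r - dist y z := by
      have := dist_triangle y w z
      rw [mem_ball] at hy
      linarith
    rw [hρ, Real.mul_rpow zero_le_two hρ0.le, ← mul_assoc] at h1
    have h3 : |f y| * ρ ^ (d / p) ≤ |f y| * (r - dist y z) ^ (d / p) := by gcongr
    exact le_of_mul_le_mul_right (h3.trans h1) (by positivity)
  have hinteg : ∫ y in ball w ρ, |f y| ∂μ ≤ N ^ (1 - p) * J := by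
    calc ∫ y in ball w ρ, |f y| ∂μ ≤ ∫ y in ball w ρ, N ^ (1 - p) * |f y| ^ p ∂μ := by
          refine setIntegral_mono_on ?_ ((hfp.mono_set hsub).const_mul _) measurableSet_ball
            fun y hy => ?_
          · exact ((hf.abs.integrableOn_compact (isCompact_closedBall z r)).mono_set
              ball_subset_closedBall).mono_set hsub
          · have h1 : |f y| = |f y| ^ (1 - p) * |f y| ^ p := by
              rw [← Real.rpow_add_of_nonneg (abs_nonneg _) (by linarith) hp0.le, sub_add_cancel,
                Real.rpow_one]
            calc |f y| = |f y| ^ (1 - p) * |f y| ^ p := h1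
              _ ≤ N ^ (1 - p) * |f y| ^ p := mul_le_mul_of_nonneg_right
                (Real.rpow_le_rpow (abs_nonneg _) (hle y hy) (by linarith)) (by positivity)
      _ = N ^ (1 - p) * ∫ y in ball w ρ, |f y| ^ p ∂μ := integral_const_mul _ _
      _ ≤ N ^ (1 - p) * J := by
          gcongr
          exact setIntegral_mono_set hfp
            (.of_forall fun _ => Real.rpow_nonneg (abs_nonneg _) _) hsub.eventuallyLE
  have hfw : |f w| ≤ A * (ρ ^ d)⁻¹ * (N ^ (1 - p) * J) := by
    refine (hmean w ρ hρ0 (closedBall_subset_closedBall' (by linarith))).trans ?_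
    gcongr
  have hNp : N ^ p * ρ ^ d ≤ A * 2 ^ (d / p) * J := by
    have h1 : N = N ^ (1 - p) * N ^ p := by
      rw [← Real.rpow_add hN0, sub_add_cancel, Real.rpow_one]
    have h2 : N ≤ A * (ρ ^ d)⁻¹ * (N ^ (1 - p) * J) * 2 ^ (d / p) := by
      rw [hN]
      gcongr
    refine le_of_mul_le_mul_left (a := N ^ (1 - p)) ?_ (by positivity)
    calc N ^ (1 - p) * (N ^ p * ρ ^ d) = N * ρ ^ d := by rw [← mul_assoc, ← h1]
      _ ≤ A * (ρ ^ d)⁻¹ * (N ^ (1 - p) * J) * 2 ^ (d / p) * ρ ^ d := by gcongr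
      _ = N ^ (1 - p) * (A * 2 ^ (d / p) * J) := by field_simp
  have hzp : |f z| ^ p * r ^ d ≤ N ^ p * ρ ^ d := by
    rw [← hpow r hr.le, ← hpow ρ hρ0.le, ← Real.mul_rpow (abs_nonneg _) (by positivity),
      ← Real.mul_rpow hN0.le (by positivity)]
    refine Real.rpow_le_rpow (by positivity) ?_ hp0.le
    rwa [hN, mul_assoc]
  rw [mul_left_comm, ← div_eq_inv_mul, le_div_iff₀ hrd]
  exact hzp.trans hNp

/-- The sub-mean value property passes from `|f|` to `|f| ^ p` for every `p > 0`. -/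
theorem exists_abs_rpow_le_of_subMeanOn [Nontrivial V] (μ : Measure V) [μ.IsAddHaarMeasure]
    {A p : ℝ} (hA : 0 < A) (hp : 0 < p) :
    ∃ K > 0, ∀ (f : V → ℝ) (z : V) (r : ℝ), 0 < r → ContinuousOn f (closedBall z r) →
      SubMeanOn μ A f (closedBall z r) →
      |f z| ^ p ≤ K * ((r ^ Module.finrank ℝ V)⁻¹ * ∫ y in ball z r, |f y| ^ p ∂μ) := by
  rcases lt_or_ge p 1 with h | h
  · exact ⟨_, by positivity, fun f z r hr hf hm => hm.abs_rpow_le_of_lt_one hA hp h hr hf⟩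
  · exact ⟨_, by positivity, fun f z r hr hf hm => hm.abs_rpow_le_of_one_le hA h hr hf⟩

end

section
variable {n : ℕ}

/-- The standard basis of `ℝⁿ × ℝ`. -/
noncomputable def upperBasis (n : ℕ) :
    Module.Basis (Fin n ⊕ Unit) ℝ (EuclideanSpace ℝ (Fin n) × ℝ) :=
  (EuclideanSpace.basisFun (Fin n) ℝ).toBasis.prod (Module.Basis.singleton Unit ℝ)

theorem norm_sq_le_sum_upperBasis_repr_sq (y : EuclideanSpace ℝ (Fin n) × ℝ) :
    ‖y‖ ^ 2 ≤ ∑ i, (upperBasis n).repr y i ^ 2 := by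
  have h : ∑ i, (upperBasis n).repr y i ^ 2 = ‖y.1‖ ^ 2 + ‖y.2‖ ^ 2 := by
    simp [upperBasis, EuclideanSpace.norm_sq_eq]
  rw [h, Prod.norm_def]
  rcases max_cases ‖y.1‖ ‖y.2‖ with h | h <;> rw [h.1] <;>
    nlinarith [sq_nonneg ‖y.1‖, sq_nonneg ‖y.2‖]

theorem HarmonicOnUpper.harmonicOnBasis {f : EuclideanSpace ℝ (Fin n) × ℝ → ℝ}
    {s : Set (EuclideanSpace ℝ (Fin n) × ℝ)} (hf : HarmonicOnUpper n f s) :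
    HarmonicOnBasis (upperBasis n) f s := by
  refine ⟨hf.1, fun w hw => ?_⟩
  simpa [upperBasis, iteratedFDeriv_two_apply] using hf.2 w hw

theorem finrank_euclideanSpace_prod_real :
    Module.finrank ℝ (EuclideanSpace ℝ (Fin n) × ℝ) = n + 1 := by simp

/-- The powers `s ^ α` and `t ^ α` are comparable when `t / 2 ≤ s ≤ 3 * t / 2`. -/
theorem exists_mul_rpow_le_rpow (α : ℝ) : ∃ c > 0, ∀ s t : ℝ, 0 < t → t / 2 ≤ s → s ≤ 3 * t / 2 →
    c * t ^ α ≤ s ^ α := by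
  refine ⟨min ((1 / 2) ^ α) ((3 / 2) ^ α), by positivity, fun s t ht h1 h2 => ?_⟩
  rcases le_total 0 α with h | h
  · calc _ ≤ (1 / 2 : ℝ) ^ α * t ^ α := by gcongr; exact min_le_left _ _
      _ = (t / 2) ^ α := by rw [← Real.mul_rpow (by norm_num) ht.le]; ring_nf
      _ ≤ s ^ α := by gcongr
  · calc _ ≤ (3 / 2 : ℝ) ^ α * t ^ α := by gcongr; exact min_le_right _ _
      _ = (3 * t / 2) ^ α := by rw [← Real.mul_rpow (by norm_num) ht.le]; ring_nf
      _ ≤ s ^ α := Real.rpow_le_rpow_of_nonpos (by linarith) h2 h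

end

theorem stmt3 (n : ℕ) (p α : ℝ) (hp : 0 < p) (hα : α > -1) :
    ∃ C > 0, ∀ f : EuclideanSpace ℝ (Fin n) × ℝ → ℝ,
      HarmonicOnUpper n f {z | 0 < z.2} →
      IntegrableOn (fun w => |f w| ^ p * w.2 ^ α)
        {w : EuclideanSpace ℝ (Fin n) × ℝ | 0 < w.2} →
      ∀ z : EuclideanSpace ℝ (Fin n) × ℝ, 0 < z.2 →
        |f z| ≤ C * z.2 ^ (-((α + n + 1) / p)) *
          (∫ w in {w : EuclideanSpace ℝ (Fin n) × ℝ | 0 < w.2},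
            |f w| ^ p * w.2 ^ α) ^ (1 / p) := by
  set H := {w : EuclideanSpace ℝ (Fin n) × ℝ | 0 < w.2}
  have : (volume : Measure (EuclideanSpace ℝ (Fin n) × ℝ)).IsAddHaarMeasure :=
    Measure.prod.instIsAddHaarMeasure _ _
  have hb := norm_sq_le_sum_upperBasis_repr_sq (n := n)
  set c₀ := ∫ y, radialWeight (upperBasis n) y
  have hc₀ : 0 < c₀ := integral_radialWeight_pos volume hb
  obtain ⟨K, hK, hKf⟩ := exists_abs_rpow_le_of_subMeanOn
    (V := EuclideanSpace ℝ (Fin n) × ℝ) volume (inv_pos.2 hc₀) hp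
  obtain ⟨c, hc, hcα⟩ := exists_mul_rpow_le_rpow α
  refine ⟨(K * 2 ^ (n + 1) * c⁻¹) ^ (1 / p), by positivity, fun f hf hinteg z hz => ?_⟩
  set I := ∫ w in H, |f w| ^ p * w.2 ^ α
  set t := z.2
  have hH : IsOpen H := isOpen_lt continuous_const continuous_snd
  have hI : 0 ≤ I := setIntegral_nonneg hH.measurableSet fun w hw =>
    mul_nonneg (Real.rpow_nonneg (abs_nonneg _) _) (Real.rpow_nonneg (le_of_lt hw) _)
  have hheight (w : EuclideanSpace ℝ (Fin n) × ℝ) (hw : w ∈ closedBall z (t / 2)) :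
      t / 2 ≤ w.2 ∧ w.2 ≤ 3 * t / 2 := by
    have h : |w.2 - t| ≤ t / 2 := by
      have h1 := norm_snd_le (w - z)
      rw [mem_closedBall, dist_eq_norm] at hw
      exact h1.trans hw
    rw [abs_le] at h
    constructor <;> linarith
  have hsub : closedBall z (t / 2) ⊆ H := fun w hw =>
    lt_of_lt_of_le (by positivity) (hheight w hw).1
  have hmean : SubMeanOn volume c₀⁻¹ f (closedBall z (t / 2)) := fun w ρ hρ hw => by
    have h := hf.harmonicOnBasis.abs_mul_integral_radialWeight_le volume hb hH hρ (hw.trans hsub)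
    rw [mul_assoc, ← div_eq_inv_mul, le_div_iff₀ hc₀]
    exact h
  have hcont : ContinuousOn f (closedBall z (t / 2)) := hf.1.continuousOn.mono hsub
  have hbase := hKf f z (t / 2) (by positivity) hcont hmean
  rw [finrank_euclideanSpace_prod_real] at hbase
  have hball : c * t ^ α * ∫ y in ball z (t / 2), |f y| ^ p ≤ I := by
    rw [← integral_const_mul]
    have hbH : ball z (t / 2) ⊆ H := ball_subset_closedBall.trans hsub
    calc ∫ y in ball z (t / 2), c * t ^ α * |f y| ^ p
        ≤ ∫ y in ball z (t / 2), |f y| ^ p * y.2 ^ α := by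
          refine setIntegral_mono_on ?_ (hinteg.mono_set hbH) measurableSet_ball fun y hy => ?_
          · exact (((hcont.abs.rpow_const fun _ _ => Or.inr hp.le).integrableOn_compact
              (isCompact_closedBall z _)).mono_set ball_subset_closedBall).const_mul _
          · have hy' := hheight y (ball_subset_closedBall hy)
            rw [mul_comm]
            gcongr
            exact hcα _ _ hz hy'.1 hy'.2
      _ ≤ I := by
          refine setIntegral_mono_set hinteg ?_ hbH.eventuallyLE
          filter_upwards [self_mem_ae_restrict hH.measurableSet] with w hw
          exact mul_nonneg (Real.rpow_nonneg (abs_nonneg _) _) (Real.rpow_nonneg (le_of_lt hw) _)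
  have hpow : |f z| ^ p ≤ K * 2 ^ (n + 1) * c⁻¹ * t ^ (-(α + n + 1)) * I := by
    have htpow : t ^ (-(α + n + 1)) = (t ^ (n + 1))⁻¹ * (t ^ α)⁻¹ := by
      rw [Real.rpow_neg hz.le, add_assoc, Real.rpow_add hz, mul_inv, mul_comm]
      congr 2
      exact_mod_cast Real.rpow_natCast t (n + 1)
    have htα : 0 < t ^ α := by positivity
    rw [mul_comm, ← le_div_iff₀ (by positivity)] at hball
    refine hbase.trans ?_
    calc _ ≤ K * (((t / 2) ^ (n + 1))⁻¹ * (I / (c * t ^ α))) := by gcongr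
      _ = _ := by
        rw [htpow, div_pow]
        field_simp
  calc |f z| = (|f z| ^ p) ^ (1 / p) := by
        rw [← Real.rpow_mul (abs_nonneg _), mul_one_div_cancel hp.ne', Real.rpow_one]
    _ ≤ (K * 2 ^ (n + 1) * c⁻¹ * t ^ (-(α + n + 1)) * I) ^ (1 / p) := by gcongr
    _ = _ := by
      rw [Real.mul_rpow (by positivity) hI, Real.mul_rpow (by positivity) (by positivity),
        ← Real.rpow_mul hz.le]
      congr 3
      ring
end

section
/- Let δ > -1, γ > n + δ, and β > 0. Suppose a kernel Q_β on the unit ball B ⊂ ℝⁿ satisfies |Q_β(x,y)| ≤ C₀ |ρ r x' - y'|^{-(n+β)} for x = r x', y = ρ y' ∈ B (x', y' on the unit sphere). Then there is a constant C such that ∫_B |Q_β(x,y)|^{γ/(n+β)} (1-|y|)^δ dy ≤ C (1-|x|)^{δ - γ + n} for all x ∈ B. -/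
open MeasureTheory
open Set Metric Module

/-- Integration in polar coordinates for the Lebesgue integral. -/
lemma lintegral_eq_lintegral_toSphere {E : Type*} [NormedAddCommGroup E] [NormedSpace ℝ E]
    [FiniteDimensional ℝ E] [Nontrivial E] [MeasurableSpace E] [BorelSpace E] (μ : Measure E)
    [μ.IsAddHaarMeasure] {f : E → ENNReal} (hf : Measurable f) :
    ∫⁻ y, f y ∂μ = ∫⁻ ω, (∫⁻ ρ in Ioi (0 : ℝ),
      ENNReal.ofReal (ρ ^ (finrank ℝ E - 1)) * f (ρ • (ω : E))) ∂μ.toSphere := by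
  calc ∫⁻ y, f y ∂μ
      = ∫⁻ y : ({(0)}ᶜ : Set E), f y ∂(μ.comap (↑)) := by
        rw [lintegral_subtype_comap (measurableSet_singleton _).compl, restrict_compl_singleton]
    _ = ∫⁻ p, f ((p.2 : ℝ) • (p.1 : E))
          ∂(μ.toSphere.prod (.volumeIoiPow (finrank ℝ E - 1))) := by
        rw [← μ.measurePreserving_homeomorphUnitSphereProd.lintegral_comp_emb
          (Homeomorph.measurableEmbedding _)]
        refine lintegral_congr fun y ↦ ?_
        rw [← homeomorphUnitSphereProd_symm_apply_coe, Homeomorph.symm_apply_apply]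
    _ = _ := by
        have hm : Measurable fun p : sphere (0 : E) 1 × Ioi (0 : ℝ) ↦ f ((p.2 : ℝ) • (p.1 : E)) := by
          fun_prop
        rw [lintegral_prod _ hm.aemeasurable]
        refine lintegral_congr fun ω ↦ ?_
        rw [Measure.volumeIoiPow, lintegral_withDensity_eq_lintegral_mul _ (by fun_prop) (by fun_prop),
          ← lintegral_subtype_comap measurableSet_Ioi]
        rfl

/-- Radial estimate: `∫₀^∞ (d + u)^{-γ} u^δ du ≲ d^{δ + 1 - γ}`. -/
lemma lintegral_add_rpow_mul_rpow_le {δ γ d : ℝ} (hδ : -1 < δ) (hγ : δ + 1 < γ) (hd : 0 < d) :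
    ∫⁻ u in Ioi (0 : ℝ), ENNReal.ofReal ((d + u) ^ (-γ) * u ^ δ) ≤
      ENNReal.ofReal (((δ + 1)⁻¹ + (γ - δ - 1)⁻¹) * d ^ (δ + 1 - γ)) := by
  have hγ0 : 0 < γ := by linarith
  rw [← Ioc_union_Ioi_eq_Ioi hd.le, add_mul,
    ENNReal.ofReal_add (mul_nonneg (inv_nonneg.2 (by linarith)) (by positivity))
      (mul_nonneg (inv_nonneg.2 (by linarith)) (by positivity))]
  refine (lintegral_union_le _ _ _).trans (add_le_add ?_ ?_)
  · have hint : IntegrableOn (fun u : ℝ ↦ d ^ (-γ) * u ^ δ) (Ioc 0 d) :=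
      ((intervalIntegrable_iff_integrableOn_Ioc_of_le hd.le).1
        (intervalIntegral.intervalIntegrable_rpow' hδ)).const_mul _
    calc ∫⁻ u in Ioc 0 d, ENNReal.ofReal ((d + u) ^ (-γ) * u ^ δ)
        ≤ ∫⁻ u in Ioc 0 d, ENNReal.ofReal (d ^ (-γ) * u ^ δ) := by
          refine setLIntegral_mono' measurableSet_Ioc fun u hu ↦ ENNReal.ofReal_le_ofReal ?_
          have := hu.1
          exact mul_le_mul_of_nonneg_right
            (Real.rpow_le_rpow_of_nonpos hd (by linarith) (by linarith)) (by positivity)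
      _ = _ := by
          rw [← ofReal_integral_eq_lintegral_ofReal hint, integral_const_mul,
            ← intervalIntegral.integral_of_le hd.le, integral_rpow (Or.inl hδ),
            Real.zero_rpow (by linarith), sub_zero, show δ + 1 - γ = -γ + (δ + 1) by ring,
            Real.rpow_add hd (-γ) (δ + 1)]
          · congr 1; ring
          · filter_upwards [ae_restrict_mem measurableSet_Ioc] with u hu
            have := hu.1
            positivity
  · calc ∫⁻ u in Ioi d, ENNReal.ofReal ((d + u) ^ (-γ) * u ^ δ)
        ≤ ∫⁻ u in Ioi d, ENNReal.ofReal (u ^ (δ - γ)) := by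
          refine setLIntegral_mono' measurableSet_Ioi fun u hu ↦ ENNReal.ofReal_le_ofReal ?_
          have hu0 : 0 < u := hd.trans hu
          rw [show δ - γ = -γ + δ by ring, Real.rpow_add hu0]
          exact mul_le_mul_of_nonneg_right
            (Real.rpow_le_rpow_of_nonpos hu0 (by linarith) (by linarith)) (by positivity)
      _ = _ := by
          rw [← ofReal_integral_eq_lintegral_ofReal (integrableOn_Ioi_rpow_of_lt (by linarith) hd),
            integral_Ioi_rpow_of_lt (by linarith) hd, show δ - γ + 1 = -(γ - δ - 1) by ring,
            show δ + 1 - γ = -(γ - δ - 1) by ring, neg_div_neg_eq]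
          · congr 1; ring
          · filter_upwards [ae_restrict_mem measurableSet_Ioi] with u hu
            have : 0 < u := hd.trans hu
            positivity

/-- `∫ (t + |x - y|)^{-s} dy` scales like `t^{n - s}`. -/
lemma lintegral_add_norm_sub_rpow {E : Type*} [NormedAddCommGroup E] [NormedSpace ℝ E]
    [FiniteDimensional ℝ E] [MeasurableSpace E] [BorelSpace E] (μ : Measure E)
    [μ.IsAddHaarMeasure] {s t : ℝ} (hs : finrank ℝ E < s) (ht : 0 < t) (x : E) :
    ∫⁻ y, ENNReal.ofReal ((t + ‖x - y‖) ^ (-s)) ∂μ =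
      ENNReal.ofReal ((∫ z, (1 + ‖z‖) ^ (-s) ∂μ) * t ^ (finrank ℝ E - s)) := by
  have hfun : ∀ z : E, (t + ‖z‖) ^ (-s) = t ^ (-s) * (1 + ‖t⁻¹ • z‖) ^ (-s) := fun z ↦ by
    rw [← Real.mul_rpow ht.le (by positivity), norm_smul, norm_inv, Real.norm_of_nonneg ht.le,
      mul_add, mul_one, mul_inv_cancel_left₀ ht.ne']
  have hint : Integrable (fun z : E ↦ (t + ‖z‖) ^ (-s)) μ := by
    simp_rw [hfun]
    exact ((integrable_one_add_norm hs).comp_smul (inv_ne_zero ht.ne')).const_mul _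
  rw [lintegral_sub_left_eq_self (fun z ↦ ENNReal.ofReal ((t + ‖z‖) ^ (-s))) x,
    ← ofReal_integral_eq_lintegral_ofReal hint (.of_forall fun z ↦ by positivity)]
  simp_rw [hfun]
  rw [integral_const_mul, Measure.integral_comp_inv_smul μ (fun z : E ↦ (1 + ‖z‖) ^ (-s)),
    abs_of_pos (by positivity), smul_eq_mul, sub_eq_add_neg, Real.rpow_add ht, Real.rpow_natCast]
  congr 1; ring

/-- Comparison of the kernel along a ray with its size at the endpoint of the ray. -/
lemma add_norm_sub_le_four_mul_norm_smul_sub {E : Type*} [NormedAddCommGroup E] [NormedSpace ℝ E]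
    {x ω : E} (hx : ‖x‖ ≤ 1) (hω : ‖ω‖ = 1) {ρ : ℝ} (hρ0 : 0 ≤ ρ) (hρ : ρ ≤ 1) :
    (1 - ‖x‖) + ‖x - ω‖ + (1 - ρ) ≤ 4 * ‖ρ • x - ω‖ := by
  have h1 : 1 - ρ * ‖x‖ ≤ ‖ρ • x - ω‖ := by
    have := norm_sub_norm_le ω (ρ • x)
    rwa [hω, norm_smul, Real.norm_of_nonneg hρ0, norm_sub_rev] at this
  have h2 : ‖x - ω‖ ≤ (1 - ρ) * ‖x‖ + ‖ρ • x - ω‖ := by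
    have := norm_add_le ((1 - ρ) • x) (ρ • x - ω)
    rwa [norm_smul, Real.norm_of_nonneg (sub_nonneg.2 hρ),
      show (1 - ρ) • x + (ρ • x - ω) = x - ω by module] at this
  nlinarith [norm_nonneg x, mul_nonneg hρ0 (sub_nonneg.2 hx),
    mul_nonneg (sub_nonneg.2 hρ) (sub_nonneg.2 hx), mul_nonneg (sub_nonneg.2 hρ) (norm_nonneg x)]

/-- Weighted integral along a ray, bounded by the size of the kernel at the end of the ray. -/
lemma lintegral_ray_kernel_le {E : Type*} [NormedAddCommGroup E] [NormedSpace ℝ E]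
    {x ω : E} (hx : ‖x‖ < 1) (hω : ‖ω‖ = 1) {δ γ : ℝ} (hδ : -1 < δ) (hγ : δ + 1 < γ) (m : ℕ) :
    ∫⁻ ρ in Ioo (0 : ℝ) 1, ENNReal.ofReal (ρ ^ m) *
        ENNReal.ofReal (‖ρ • x - ω‖ ^ (-γ) * (1 - ρ) ^ δ) ≤
      ENNReal.ofReal (4 ^ γ * ((δ + 1)⁻¹ + (γ - δ - 1)⁻¹) *
        ((1 - ‖x‖) + ‖x - ω‖) ^ (δ + 1 - γ)) := by
  set d := (1 - ‖x‖) + ‖x - ω‖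
  have hd : 0 < d := add_pos_of_pos_of_nonneg (sub_pos.2 hx) (norm_nonneg _)
  set g : ℝ → ENNReal := (Ioi (0 : ℝ)).indicator
    fun u ↦ ENNReal.ofReal (4 ^ γ) * ENNReal.ofReal ((d + u) ^ (-γ) * u ^ δ)
  calc _ ≤ ∫⁻ ρ in Ioo (0 : ℝ) 1, g (1 - ρ) := by
        refine setLIntegral_mono' measurableSet_Ioo fun ρ ⟨h0, h1⟩ ↦ ?_
        have hu : 0 < 1 - ρ := sub_pos.2 h1
        have hk : ‖ρ • x - ω‖ ^ (-γ) ≤ 4 ^ γ * (d + (1 - ρ)) ^ (-γ) := by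
          have := add_norm_sub_le_four_mul_norm_smul_sub hx.le hω h0.le h1.le
          calc ‖ρ • x - ω‖ ^ (-γ) ≤ (4⁻¹ * (d + (1 - ρ))) ^ (-γ) :=
                Real.rpow_le_rpow_of_nonpos (by positivity) (by linarith) (by linarith)
            _ = _ := by
                rw [Real.mul_rpow (by norm_num) (by positivity), Real.inv_rpow (by norm_num),
                  Real.rpow_neg (by norm_num), inv_inv]
        simp only [g]
        rw [indicator_of_mem (mem_Ioi.2 hu), ← ENNReal.ofReal_mul (by positivity),
          ← ENNReal.ofReal_mul (by positivity)]
        refine ENNReal.ofReal_le_ofReal ?_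
        calc ρ ^ m * (‖ρ • x - ω‖ ^ (-γ) * (1 - ρ) ^ δ)
            ≤ 1 * (4 ^ γ * (d + (1 - ρ)) ^ (-γ) * (1 - ρ) ^ δ) := by
              gcongr
              exact pow_le_one₀ h0.le h1.le
          _ = _ := by ring
    _ ≤ ∫⁻ ρ, g (1 - ρ) := setLIntegral_le_lintegral _ _
    _ = ∫⁻ u, g u := lintegral_sub_left_eq_self g 1
    _ = ENNReal.ofReal (4 ^ γ) *
          ∫⁻ u in Ioi (0 : ℝ), ENNReal.ofReal ((d + u) ^ (-γ) * u ^ δ) := by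
        rw [lintegral_indicator measurableSet_Ioi, lintegral_const_mul' _ _ ENNReal.ofReal_ne_top]
    _ ≤ _ := by
        rw [mul_assoc, ENNReal.ofReal_mul (by positivity)]
        gcongr
        exact lintegral_add_rpow_mul_rpow_le hδ hγ hd

/-- Lower bound for the unweighted integral along a ray. -/
lemma le_lintegral_ray {E : Type*} [NormedAddCommGroup E] [NormedSpace ℝ E]
    {x ω : E} (hx : ‖x‖ < 1) (hω : ‖ω‖ = 1) {s : ℝ} (hs : 0 ≤ s) (m : ℕ) :
    ENNReal.ofReal (((1 - ‖x‖) + ‖x - ω‖) ^ (1 - s)) ≤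
      ENNReal.ofReal (2 ^ m * 2 ^ s * 8) * ∫⁻ ρ in Ioi (0 : ℝ), ENNReal.ofReal (ρ ^ m) *
        ENNReal.ofReal (((1 - ‖x‖) + ‖x - ρ • ω‖) ^ (-s)) := by
  set d := (1 - ‖x‖) + ‖x - ω‖
  have hd : 0 < d := add_pos_of_pos_of_nonneg (sub_pos.2 hx) (norm_nonneg _)
  have hd4 : d ≤ 4 := by
    have := norm_sub_le x ω
    linarith
  have key : ENNReal.ofReal ((1 / 2) ^ m * (2 * d) ^ (-s) * (d / 8)) ≤
      ∫⁻ ρ in Ioi (0 : ℝ), ENNReal.ofReal (ρ ^ m) *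
        ENNReal.ofReal (((1 - ‖x‖) + ‖x - ρ • ω‖) ^ (-s)) := by
    calc ENNReal.ofReal ((1 / 2) ^ m * (2 * d) ^ (-s) * (d / 8))
        = ∫⁻ ρ in Ioo (1 - d / 8) 1, ENNReal.ofReal ((1 / 2) ^ m * (2 * d) ^ (-s)) := by
          rw [setLIntegral_const, Real.volume_Ioo, sub_sub_cancel,
            ← ENNReal.ofReal_mul (by positivity)]
      _ ≤ ∫⁻ ρ in Ioo (1 - d / 8) 1, ENNReal.ofReal (ρ ^ m) *
            ENNReal.ofReal (((1 - ‖x‖) + ‖x - ρ • ω‖) ^ (-s)) := by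
          refine setLIntegral_mono' measurableSet_Ioo fun ρ ⟨h0, h1⟩ ↦ ?_
          have hρ : 1 / 2 ≤ ρ := by linarith
          have hn : ‖x - ρ • ω‖ ≤ ‖x - ω‖ + (1 - ρ) := by
            have := norm_add_le (x - ω) ((1 - ρ) • ω)
            rwa [norm_smul, hω, mul_one, Real.norm_of_nonneg (by linarith),
              show x - ω + (1 - ρ) • ω = x - ρ • ω by module] at this
          rw [← ENNReal.ofReal_mul (by positivity)]
          refine ENNReal.ofReal_le_ofReal (mul_le_mul (by gcongr) ?_ (by positivity) (by positivity))
          exact Real.rpow_le_rpow_of_nonpos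
            (add_pos_of_pos_of_nonneg (sub_pos.2 hx) (norm_nonneg _)) (by linarith) (by linarith)
      _ ≤ _ := lintegral_mono_set fun ρ hρ ↦ by
          have := hρ.1
          simp only [mem_Ioi]
          linarith
  refine le_trans (le_of_eq ?_) (mul_le_mul_right key _)
  rw [← ENNReal.ofReal_mul (by positivity), Real.mul_rpow (by norm_num) hd.le,
    Real.rpow_neg (by norm_num), sub_eq_neg_add, Real.rpow_add hd, Real.rpow_one]
  congr 1
  field_simp
  rw [← mul_pow]
  norm_num

/-- The weighted integral of `|ρ x - y'|^{-γ}`, `y = ρ y'`, over the unit ball. -/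
lemma exists_lintegral_ball_kernel_le {E : Type*} [NormedAddCommGroup E] [NormedSpace ℝ E]
    [FiniteDimensional ℝ E] [Nontrivial E] [MeasurableSpace E] [BorelSpace E] (μ : Measure E)
    [μ.IsAddHaarMeasure] {δ γ : ℝ} (hδ : -1 < δ) (hγ : finrank ℝ E + δ < γ) :
    ∃ C, 0 ≤ C ∧ ∀ x ∈ ball (0 : E) 1,
      ∫⁻ y in ball (0 : E) 1,
          ENNReal.ofReal (‖‖y‖ • x - ‖y‖⁻¹ • y‖ ^ (-γ) * (1 - ‖y‖) ^ δ) ∂μ ≤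
        ENNReal.ofReal (C * (1 - ‖x‖) ^ (δ - γ + finrank ℝ E)) := by
  have hdim : (1 : ℝ) ≤ finrank ℝ E := by exact_mod_cast finrank_pos (R := ℝ) (M := E)
  have hγ' : δ + 1 < γ := by linarith
  set m := finrank ℝ E - 1 with hm
  set A : ℝ := 4 ^ γ * ((δ + 1)⁻¹ + (γ - δ - 1)⁻¹)
  have hA0 : 0 ≤ A := mul_nonneg (by positivity)
    (add_nonneg (inv_nonneg.2 (by linarith)) (inv_nonneg.2 (by linarith)))
  set K : ℝ := 2 ^ m * 2 ^ (γ - δ) * 8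
  have hK0 : 0 ≤ K := by positivity
  set I : ℝ := ∫ z, (1 + ‖z‖) ^ (-(γ - δ)) ∂μ
  have hI0 : 0 ≤ I := integral_nonneg fun z ↦ by positivity
  refine ⟨A * K * I, by positivity, fun x hx ↦ ?_⟩
  rw [mem_ball_zero_iff] at hx
  rw [← lintegral_indicator measurableSet_ball, lintegral_eq_lintegral_toSphere μ
    (Measurable.indicator (by fun_prop) measurableSet_ball)]
  calc _ ≤ ∫⁻ ω, ENNReal.ofReal (A * K) * (∫⁻ ρ in Ioi (0 : ℝ), ENNReal.ofReal (ρ ^ m) *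
          ENNReal.ofReal (((1 - ‖x‖) + ‖x - ρ • (ω : E)‖) ^ (-(γ - δ)))) ∂μ.toSphere := by
        refine lintegral_mono fun ω ↦ ?_
        have hω : ‖(ω : E)‖ = 1 := mem_sphere_zero_iff_norm.1 ω.2
        calc _ = ∫⁻ ρ in Ioo (0 : ℝ) 1, ENNReal.ofReal (ρ ^ m) *
                  ENNReal.ofReal (‖ρ • x - (ω : E)‖ ^ (-γ) * (1 - ρ) ^ δ) := by
              rw [← lintegral_indicator measurableSet_Ioi, ← lintegral_indicator measurableSet_Ioo]
              refine lintegral_congr fun ρ ↦ ?_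
              by_cases h0 : 0 < ρ
              · by_cases h1 : ρ < 1
                · simp [h0, h1, norm_smul, hω, abs_of_pos h0, h0.ne', smul_smul, indicator, hm]
                · simp [h0, h1, norm_smul, hω, abs_of_pos h0, indicator]
              · simp [h0]
          _ ≤ _ := lintegral_ray_kernel_le hx hω hδ hγ' m
          _ ≤ _ := by
              rw [ENNReal.ofReal_mul hA0, ENNReal.ofReal_mul hA0, mul_assoc,
                show δ + 1 - γ = 1 - (γ - δ) by ring]
              gcongr
              exact le_lintegral_ray hx hω (by linarith) m
    _ = ENNReal.ofReal (A * K) *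
          ∫⁻ y, ENNReal.ofReal (((1 - ‖x‖) + ‖x - y‖) ^ (-(γ - δ))) ∂μ := by
        rw [lintegral_const_mul' _ _ ENNReal.ofReal_ne_top,
          lintegral_eq_lintegral_toSphere μ (by fun_prop)]
    _ = _ := by
        rw [lintegral_add_norm_sub_rpow μ (by linarith) (sub_pos.2 hx),
          ← ENNReal.ofReal_mul (by positivity), ← mul_assoc]
        congr 3
        ring

theorem stmt7 (n : ℕ) (δ γ β C₀ : ℝ) (hδ : δ > -1) (hγ : γ > n + δ) (hβ : 0 < β)
    (Q : EuclideanSpace ℝ (Fin n) → EuclideanSpace ℝ (Fin n) → ℝ)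
    (hQ : ∀ x ∈ Metric.ball (0 : EuclideanSpace ℝ (Fin n)) 1,
      ∀ y ∈ Metric.ball (0 : EuclideanSpace ℝ (Fin n)) 1, y ≠ 0 →
        |Q x y| ≤ C₀ * ‖‖y‖ • x - ‖y‖⁻¹ • y‖ ^ (-((n : ℝ) + β))) :
    ∃ C > 0, ∀ x ∈ Metric.ball (0 : EuclideanSpace ℝ (Fin n)) 1,
      (∫ y in Metric.ball (0 : EuclideanSpace ℝ (Fin n)) 1,
          |Q x y| ^ (γ / ((n : ℝ) + β)) * (1 - ‖y‖) ^ δ) ≤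
        C * (1 - ‖x‖) ^ (δ - γ + n) := by
  rcases Nat.eq_zero_or_pos n with rfl | hn
  · refine ⟨|∫ y in Metric.ball (0 : EuclideanSpace ℝ (Fin 0)) 1,
      |Q 0 y| ^ (γ / (((0 : ℕ) : ℝ) + β)) * (1 - ‖y‖) ^ δ| + 1, by positivity, fun x _ ↦ ?_⟩
    rw [Subsingleton.elim x 0, norm_zero, sub_zero, Real.one_rpow, mul_one]
    exact (le_abs_self _).trans (le_add_of_nonneg_right zero_le_one)
  have : Nonempty (Fin n) := ⟨⟨0, hn⟩⟩
  have hn1 : (1 : ℝ) ≤ n := by exact_mod_cast hn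
  have hp : 0 ≤ γ / (n + β) := div_nonneg (by linarith) (by linarith)
  obtain ⟨C, hC, hbound⟩ := exists_lintegral_ball_kernel_le
    (volume : Measure (EuclideanSpace ℝ (Fin n))) hδ (by simpa using hγ)
  simp only [finrank_euclideanSpace_fin] at hbound
  set P : ℝ := |C₀| ^ (γ / (n + β))
  have hP : 0 ≤ P := by positivity
  refine ⟨P * C + 1, by positivity, fun x hx ↦ ?_⟩
  have hx1 : 0 < 1 - ‖x‖ := sub_pos.2 (mem_ball_zero_iff.1 hx)
  set k : EuclideanSpace ℝ (Fin n) → ℝ :=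
    fun y ↦ ‖‖y‖ • x - ‖y‖⁻¹ • y‖ ^ (-γ) * (1 - ‖y‖) ^ δ with hk
  have hk0 : 0 ≤ᵐ[volume.restrict (ball 0 1)] k := by
    filter_upwards [ae_restrict_mem measurableSet_ball] with y hy
    have : 0 ≤ 1 - ‖y‖ := sub_nonneg.2 (mem_ball_zero_iff.1 hy).le
    simp only [hk, Pi.zero_apply]
    positivity
  have hkm : Measurable k := by fun_prop
  have hki : IntegrableOn k (ball 0 1) :=
    (lintegral_ofReal_ne_top_iff_integrable hkm.aestronglyMeasurable hk0).1
      ((hbound x hx).trans_lt ENNReal.ofReal_lt_top).ne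
  have hk_le : ∫ y in ball 0 1, k y ≤ C * (1 - ‖x‖) ^ (δ - γ + n) := by
    rw [integral_eq_lintegral_of_nonneg_ae hk0 hkm.aestronglyMeasurable]
    exact ENNReal.toReal_le_of_le_ofReal (by positivity) (hbound x hx)
  calc _ ≤ ∫ y in ball 0 1, P * k y := by
        refine integral_mono_of_nonneg ?_ (hki.const_mul P) ?_
        · filter_upwards [ae_restrict_mem measurableSet_ball] with y hy
          have : 0 ≤ 1 - ‖y‖ := sub_nonneg.2 (mem_ball_zero_iff.1 hy).le
          simp only [Pi.zero_apply]
          positivity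
        · filter_upwards [ae_restrict_mem measurableSet_ball,
            ae_restrict_of_ae (Measure.ae_ne volume 0)] with y hy hy0
          have h1 : 0 ≤ 1 - ‖y‖ := sub_nonneg.2 (mem_ball_zero_iff.1 hy).le
          simp only [hk]
          rw [← mul_assoc]
          refine mul_le_mul_of_nonneg_right ?_ (by positivity)
          calc |Q x y| ^ (γ / (n + β))
              ≤ (|C₀| * ‖‖y‖ • x - ‖y‖⁻¹ • y‖ ^ (-((n : ℝ) + β))) ^ (γ / (n + β)) := by
                refine Real.rpow_le_rpow (abs_nonneg _) ((hQ x hx y hy hy0).trans ?_) hp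
                gcongr
                exact le_abs_self _
            _ = _ := by
                rw [Real.mul_rpow (abs_nonneg _) (by positivity), ← Real.rpow_mul (norm_nonneg _),
                  neg_mul, mul_div_cancel₀ _ (by positivity)]
    _ = P * ∫ y in ball 0 1, k y := integral_const_mul _ _
    _ ≤ P * (C * (1 - ‖x‖) ^ (δ - γ + n)) := by gcongr
    _ ≤ (P * C + 1) * (1 - ‖x‖) ^ (δ - γ + n) := by
        rw [← mul_assoc]
        gcongr
        linarith
end
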